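/- There exist constants δ, δ′ ∈ (0,1) such that the following holds. Let d = (d_1,…,d_n) be a degree sequence with m = (∑_v d_v)/2 an integer and max_v d_v < √m / 2, and let G be drawn from ECM(d) with MinBucket buckets formed. For any three distinct vertices v, w, w′ with d_w < δ·d_v, one has E[Y_{v,w}·Y_{v,w′}] ≤ 2·exp(−δ′ d_v)·d_v²·d_w·d_{w′}/m². -/

import Mathlib

open Finset

noncomputable section
attribute [local instance] Classical.propDecidable

/-- The perfect matchings of the stub set `Fin N`: fixed-point-free involutions. -/
def matchings (N : ℕ) : Finset (Equiv.Perm (Fin N)) :=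
  Finset.univ.filter fun M => ∀ s, M (M s) = s ∧ M s ≠ s

/-- `φ` is a stub map for the degree sequence `d`: vertex `v` owns exactly `d v` stubs. -/
def IsStubMap {n N : ℕ} (d : Fin n → ℕ) (φ : Fin N → Fin n) : Prop :=
  ∀ v, (Finset.univ.filter fun s => φ s = v).card = d v

/-- Adjacency in the erased (simple) graph: distinct vertices joined by a matched stub pair. -/
def ecmAdj {n N : ℕ} (φ : Fin N → Fin n) (M : Equiv.Perm (Fin N)) (u v : Fin n) : Prop :=
  u ≠ v ∧ ∃ s, φ s = u ∧ φ (M s) = v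

/-- The degree `D_v` of vertex `v` in the erased graph. -/
def ecmDeg {n N : ℕ} (φ : Fin N → Fin n) (M : Equiv.Perm (Fin N)) (v : Fin n) : ℕ :=
  (Finset.univ.filter fun u => ecmAdj φ M u v).card

/-- The edge `(v,w)` is present and lies in `v`'s bucket:
`(D_v, v) ≤ (D_w, w)` lexicographically. -/
def inBucket {n N : ℕ} (φ : Fin N → Fin n) (M : Equiv.Perm (Fin N)) (v w : Fin n) : Prop :=
  ecmAdj φ M v w ∧
    (ecmDeg φ M v < ecmDeg φ M w ∨ (ecmDeg φ M v = ecmDeg φ M w ∧ v ≤ w))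

/-- Indicator `Y_{v,w}` that the edge `(v,w)` is present and in `v`'s bucket. -/
def ecmY {n N : ℕ} (φ : Fin N → Fin n) (M : Equiv.Perm (Fin N)) (v w : Fin n) : ℝ :=
  if inBucket φ M v w then 1 else 0

/-- `X_v`, the number of edges in `v`'s bucket. -/
def ecmX {n N : ℕ} (φ : Fin N → Fin n) (M : Equiv.Perm (Fin N)) (v : Fin n) : ℝ :=
  ∑ w, ecmY φ M v w

/-- Expectation over the uniformly random perfect matching. -/
def ecmExp (N : ℕ) (g : Equiv.Perm (Fin N) → ℝ) : ℝ :=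
  (∑ M ∈ matchings N, g M) / ((matchings N).card : ℝ)

/-- Probability of an event over the uniformly random perfect matching. -/
def ecmProb (N : ℕ) (A : Equiv.Perm (Fin N) → Prop) : ℝ :=
  (((matchings N).filter A).card : ℝ) / ((matchings N).card : ℝ)

/-- The matchings that agree with `M₀` on the stub set `A`. -/
def matchingsAgreeing {N : ℕ} (M₀ : Equiv.Perm (Fin N)) (A : Finset (Fin N)) :
    Finset (Equiv.Perm (Fin N)) :=
  (matchings N).filter fun M => ∀ a ∈ A, M a = M₀ a

/-- The vertices `u ≠ v` that are matched to some stub of `v` lying in `B`. -/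
def neighborsVia {n N : ℕ} (φ : Fin N → Fin n) (v : Fin n) (M : Equiv.Perm (Fin N))
    (B : Finset (Fin N)) : Finset (Fin n) :=
  ((B.filter fun s => φ s = v).image fun s => φ (M s)).erase v

theorem mem_matchings {N : ℕ} {M : Equiv.Perm (Fin N)} :
    M ∈ matchings N ↔ ∀ s, M (M s) = s ∧ M s ≠ s := by
  simp [matchings]

theorem mem_matchingsAgreeing {N : ℕ} {M₀ M : Equiv.Perm (Fin N)} {A : Finset (Fin N)} :
    M ∈ matchingsAgreeing M₀ A ↔ M ∈ matchings N ∧ ∀ a ∈ A, M a = M₀ a := by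
  simp [matchingsAgreeing]

theorem matchingsAgreeing_empty {N : ℕ} (M₀ : Equiv.Perm (Fin N)) :
    matchingsAgreeing M₀ ∅ = matchings N := by
  simp [matchingsAgreeing]

/-- Relabelling partners by a transposition shows that one partner of `s` is no more likely
than another. -/
theorem card_filter_partner_le {N : ℕ} {M₀ : Equiv.Perm (Fin N)} {A : Finset (Fin N)}
    (hA : ∀ a ∈ A, M₀ a ∈ A) {s t t' : Fin N}
    (ht : t ∉ A) (hts : t ≠ s) (ht' : t' ∉ A) (hts' : t' ≠ s) :
    ((matchingsAgreeing M₀ A).filter fun M => M s = t).card ≤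
      ((matchingsAgreeing M₀ A).filter fun M => M s = t').card := by
  refine Finset.card_le_card_of_injOn
    (fun M => Equiv.swap t t' * M * Equiv.swap t t') ?_ ?_
  · intro M hM
    simp only [Finset.mem_coe, Finset.mem_filter, mem_matchingsAgreeing, mem_matchings] at hM ⊢
    obtain ⟨⟨hM, hMA⟩, hMs⟩ := hM
    refine ⟨⟨fun u => ⟨?_, ?_⟩, ?_⟩, ?_⟩
    · simp [(hM _).1]
    · intro h
      refine (hM (Equiv.swap t t' u)).2 ?_
      have h' := congrArg (Equiv.swap t t') h
      simpa using h'
    · intro a ha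
      have hne : ∀ b ∈ A, Equiv.swap t t' b = b := fun b hb =>
        Equiv.swap_apply_of_ne_of_ne (fun h => ht (h ▸ hb)) (fun h => ht' (h ▸ hb))
      simp only [Equiv.Perm.mul_apply]
      rw [hne a ha, hMA a ha, hne _ (hA a ha)]
    · simp only [Equiv.Perm.mul_apply]
      rw [Equiv.swap_apply_of_ne_of_ne hts.symm hts'.symm, hMs, Equiv.swap_apply_left]
  · intro M _ M' _ h
    simpa using h

theorem partner_notMem {N : ℕ} {M₀ M : Equiv.Perm (Fin N)} {A : Finset (Fin N)}
    (hA : ∀ a ∈ A, M₀ a ∈ A) (hM : M ∈ matchingsAgreeing M₀ A) {s : Fin N} (hs : s ∉ A) :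
    M s ∈ (insert s A)ᶜ := by
  rw [mem_matchingsAgreeing, mem_matchings] at hM
  simp only [Finset.mem_compl, Finset.mem_insert, not_or]
  refine ⟨(hM.1 s).2, fun h => hs ?_⟩
  have h' := hM.2 _ h
  rw [(hM.1 s).1] at h'
  rw [h']
  exact hA _ h

/-- Given the matching on the closed set `A`, the partner of a further stub is uniform. -/
theorem card_filter_partner_mul {N : ℕ} {M₀ : Equiv.Perm (Fin N)} {A : Finset (Fin N)}
    (hA : ∀ a ∈ A, M₀ a ∈ A) {s t : Fin N} (hs : s ∉ A) (ht : t ∈ (insert s A)ᶜ) :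
    (insert s A)ᶜ.card * ((matchingsAgreeing M₀ A).filter fun M => M s = t).card =
      (matchingsAgreeing M₀ A).card := by
  rw [Finset.card_eq_sum_card_fiberwise (f := fun M : Equiv.Perm (Fin N) => M s)
    (t := (insert s A)ᶜ) (fun M hM => partner_notMem hA hM hs)]
  rw [← smul_eq_mul, ← Finset.sum_const]
  refine Finset.sum_congr rfl fun t' ht' => ?_
  simp only [Finset.mem_compl, Finset.mem_insert, not_or] at ht ht'
  exact le_antisymm (card_filter_partner_le hA ht.2 ht.1 ht'.2 ht'.1)
    (card_filter_partner_le hA ht'.2 ht'.1 ht.2 ht.1)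

theorem card_compl_insert {N : ℕ} {A : Finset (Fin N)} {s : Fin N} (hs : s ∉ A) :
    ((insert s A)ᶜ.card : ℝ) = N - A.card - 1 := by
  have h := Finset.card_add_card_compl (insert s A)
  rw [Finset.card_insert_of_notMem hs, Fintype.card_fin] at h
  have h' : ((A.card + 1 + (insert s A)ᶜ.card : ℕ) : ℝ) = N := by rw [h]
  push_cast at h'
  linarith

/-- Exposing the pair `{s, M₁ s}` refines the conditioning. -/
theorem filter_partner_eq {N : ℕ} {M₀ M₁ : Equiv.Perm (Fin N)} {A : Finset (Fin N)}
    {s t : Fin N} (hM₁ : M₁ ∈ (matchingsAgreeing M₀ A).filter fun M => M s = t) :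
    ((matchingsAgreeing M₀ A).filter fun M => M s = t) =
      matchingsAgreeing M₁ (insert t (insert s A)) := by
  simp only [Finset.mem_filter, mem_matchingsAgreeing, mem_matchings] at hM₁
  obtain ⟨⟨h1, h2⟩, h3⟩ := hM₁
  have h4 : M₁ t = s := by rw [← h3]; exact (h1 s).1
  ext M
  simp only [Finset.mem_filter, mem_matchingsAgreeing, mem_matchings, Finset.mem_insert,
    forall_eq_or_imp]
  constructor
  · rintro ⟨⟨hM, hA⟩, hs⟩
    refine ⟨hM, ?_, by rw [hs, h3], fun a ha => by rw [hA a ha, h2 a ha]⟩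
    rw [h4, ← hs]
    exact (hM s).1
  · rintro ⟨hM, -, hs, hA⟩
    exact ⟨⟨hM, fun a ha => by rw [hA a ha, h2 a ha]⟩, by rw [hs, h3]⟩

theorem closed_insert_pair {N : ℕ} {M₀ M₁ : Equiv.Perm (Fin N)} {A : Finset (Fin N)}
    (hA : ∀ a ∈ A, M₀ a ∈ A) {s t : Fin N}
    (hM₁ : M₁ ∈ (matchingsAgreeing M₀ A).filter fun M => M s = t) :
    ∀ a ∈ insert t (insert s A), M₁ a ∈ insert t (insert s A) := by
  simp only [Finset.mem_filter, mem_matchingsAgreeing, mem_matchings] at hM₁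
  obtain ⟨⟨h1, h2⟩, h3⟩ := hM₁
  have h4 : M₁ t = s := by rw [← h3]; exact (h1 s).1
  simp only [Finset.mem_insert, forall_eq_or_imp]
  exact ⟨Or.inr (Or.inl h4), Or.inl h3, fun a ha => Or.inr (Or.inr (h2 a ha ▸ hA a ha))⟩

/-- The stubs of `v` outside `A`. -/
def freeStubs {n N : ℕ} (φ : Fin N → Fin n) (v : Fin n) (A : Finset (Fin N)) :
    Finset (Fin N) :=
  Aᶜ.filter fun s => φ s = v

theorem freeStubs_insert_of_eq {n N : ℕ} (φ : Fin N → Fin n) {v : Fin n}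
    {A : Finset (Fin N)} {s : Fin N} (hs : s ∉ A) (hv : φ s = v) :
    (freeStubs φ v (insert s A)).card + 1 = (freeStubs φ v A).card := by
  have h : freeStubs φ v (insert s A) = (freeStubs φ v A).erase s := by
    ext u
    simp [freeStubs, and_assoc]
  rw [h, Finset.card_erase_add_one]
  simp [freeStubs, hs, hv]

theorem freeStubs_insert_of_ne {n N : ℕ} (φ : Fin N → Fin n) {v : Fin n}
    {A : Finset (Fin N)} {s : Fin N} (hv : φ s ≠ v) :
    freeStubs φ v (insert s A) = freeStubs φ v A := by
  ext u
  simp only [freeStubs, Finset.mem_filter, Finset.mem_compl, Finset.mem_insert, not_or]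
  constructor
  · rintro ⟨⟨_, h1⟩, h2⟩
    exact ⟨h1, h2⟩
  · rintro ⟨h1, h2⟩
    exact ⟨⟨fun h => hv (h ▸ h2), h1⟩, h2⟩

theorem neighborsVia_congr {n N : ℕ} (φ : Fin N → Fin n) (v : Fin n)
    {M M' : Equiv.Perm (Fin N)} {B : Finset (Fin N)} (h : ∀ a ∈ B, M a = M' a) :
    neighborsVia φ v M B = neighborsVia φ v M' B := by
  unfold neighborsVia
  congr 1
  refine Finset.image_congr fun a ha => ?_
  simp only [Finset.coe_filter, Set.mem_ofPred_eq] at ha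
  simp only [h a ha.1]

theorem neighborsVia_mono {n N : ℕ} (φ : Fin N → Fin n) (v : Fin n)
    (M : Equiv.Perm (Fin N)) {B C : Finset (Fin N)} (h : B ⊆ C) :
    neighborsVia φ v M B ⊆ neighborsVia φ v M C :=
  Finset.erase_subset_erase _ (Finset.image_subset_image (Finset.filter_subset_filter _ h))

theorem card_neighborsVia_le {n N : ℕ} (φ : Fin N → Fin n) (v : Fin n)
    (M : Equiv.Perm (Fin N)) (B : Finset (Fin N)) :
    (neighborsVia φ v M B).card ≤ (univ.filter fun s => φ s = v).card :=
  Finset.card_erase_le.trans (Finset.card_image_le.trans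
    (Finset.card_le_card (Finset.filter_subset_filter _ (Finset.subset_univ _))))

theorem card_neighborsVia_lt {n N : ℕ} (φ : Fin N → Fin n) {v : Fin n}
    {M M' : Equiv.Perm (Fin N)} {B C : Finset (Fin N)} (hBC : B ⊆ C)
    (h : ∀ a ∈ B, M a = M' a) {s : Fin N} (hs : s ∈ C) (hsv : φ s = v)
    (hv : φ (M s) ≠ v) (hnew : φ (M s) ∉ neighborsVia φ v M' B) :
    (neighborsVia φ v M' B).card + 1 ≤ (neighborsVia φ v M C).card := by
  rw [← neighborsVia_congr φ v h] at hnew ⊢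
  refine Finset.card_lt_card (Finset.ssubset_iff_subset_ne.2 ⟨neighborsVia_mono φ v M hBC, ?_⟩)
  intro heq
  apply hnew
  rw [heq]
  simp only [neighborsVia, Finset.mem_erase, Finset.mem_image, Finset.mem_filter]
  exact ⟨hv, s, ⟨hs, hsv⟩, rfl⟩

/-- The factor gained by exposing a pair `{s, t}` with `s` a stub of `v`. -/
def exposureFactor {n N : ℕ} (φ : Fin N → Fin n) (v : Fin n) (S : Finset (Fin n))
    (t : Fin N) : ℝ :=
  1 / 4 + (if φ t = v then 4 else 0) + (if φ t ∈ S then 2 else 0)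

theorem sum_exposureFactor_le {n N : ℕ} (φ : Fin N → Fin n) (v : Fin n)
    (S : Finset (Fin n)) {K : ℕ} (hK : ∀ u, (univ.filter fun s => φ s = u).card ≤ K)
    (T : Finset (Fin N)) :
    ∑ t ∈ T, exposureFactor φ v S t ≤
      (T.card : ℝ) / 4 + 4 * ((univ.filter fun s => φ s = v).card : ℝ) + 2 * (S.card * K) := by
  unfold exposureFactor
  rw [Finset.sum_add_distrib, Finset.sum_add_distrib, ← Finset.sum_filter, ← Finset.sum_filter]
  simp only [Finset.sum_const, nsmul_eq_mul]
  have h1 : ((T.filter fun t => φ t = v).card : ℝ) ≤ (univ.filter fun s => φ s = v).card := by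
    exact_mod_cast Finset.card_le_card (Finset.filter_subset_filter _ (Finset.subset_univ _))
  have h2 : ((T.filter fun t => φ t ∈ S).card : ℝ) ≤ S.card * K := by
    have h3 : (T.filter fun t => φ t ∈ S).card ≤ S.card * K := by
      rw [mul_comm]
      refine Finset.card_le_mul_card_image_of_maps_to (f := φ)
        (fun t ht => (Finset.mem_filter.1 ht).2) K fun u _ => ?_
      refine (Finset.card_le_card ?_).trans (hK u)
      exact Finset.filter_subset_filter _ (Finset.subset_univ _)
    exact_mod_cast h3
  linarith

/-- One exposure step multiplies the bound by at most `exposureFactor`. -/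
theorem exposure_step {n N : ℕ} (φ : Fin N → Fin n) {v : Fin n}
    {M₀ M₁ : Equiv.Perm (Fin N)} {A : Finset (Fin N)} {s t : Fin N} (hs : s ∉ A)
    (hsv : φ s = v) (ht : t ∈ (insert s A)ᶜ)
    (hM₁ : M₁ ∈ (matchingsAgreeing M₀ A).filter fun M => M s = t) :
    (1 / 2 : ℝ) ^ (freeStubs φ v (insert t (insert s A))).card *
        (1 / 8) ^ (neighborsVia φ v M₁ (insert t (insert s A))).card ≤
      (1 / 2) ^ (freeStubs φ v A).card * (1 / 8) ^ (neighborsVia φ v M₀ A).card *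
        exposureFactor φ v (neighborsVia φ v M₀ A) t := by
  simp only [Finset.mem_filter, mem_matchingsAgreeing] at hM₁
  obtain ⟨⟨-, hagree⟩, hM₁s⟩ := hM₁
  have ht' : t ∉ insert s A := Finset.mem_compl.1 ht
  have hsub : A ⊆ insert t (insert s A) :=
    (Finset.subset_insert _ _).trans (Finset.subset_insert _ _)
  have hmono : (neighborsVia φ v M₀ A).card ≤
      (neighborsVia φ v M₁ (insert t (insert s A))).card := by
    rw [← neighborsVia_congr φ v hagree]
    exact Finset.card_le_card (neighborsVia_mono φ v M₁ hsub)
  have hpow : (1 / 8 : ℝ) ^ (neighborsVia φ v M₁ (insert t (insert s A))).card ≤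
      (1 / 8) ^ (neighborsVia φ v M₀ A).card :=
    pow_le_pow_of_le_one (by norm_num) (by norm_num) hmono
  have hfree := freeStubs_insert_of_eq φ hs hsv
  rw [← hfree, pow_succ]
  by_cases htv : φ t = v
  · rw [← freeStubs_insert_of_eq φ ht' htv, pow_succ]
    have hfac : 4 ≤ exposureFactor φ v (neighborsVia φ v M₀ A) t := by
      unfold exposureFactor
      rw [if_pos htv]
      split_ifs <;> norm_num
    set p := (1 / 2 : ℝ) ^ (freeStubs φ v (insert t (insert s A))).card
    have hp : 0 ≤ p := by positivity
    calc _ ≤ p * (1 / 8) ^ (neighborsVia φ v M₀ A).card := by gcongr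
      _ = p * (1 / 2) * (1 / 2) * (1 / 8) ^ (neighborsVia φ v M₀ A).card * 4 := by ring
      _ ≤ _ := by gcongr
  · rw [freeStubs_insert_of_ne φ htv]
    set p := (1 / 2 : ℝ) ^ (freeStubs φ v (insert s A)).card
    have hp : 0 ≤ p := by positivity
    by_cases hmem : φ t ∈ neighborsVia φ v M₀ A
    · have hfac : 2 ≤ exposureFactor φ v (neighborsVia φ v M₀ A) t := by
        unfold exposureFactor
        rw [if_neg htv, if_pos hmem]
        norm_num
      calc _ ≤ p * (1 / 8) ^ (neighborsVia φ v M₀ A).card := by gcongr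
        _ = p * (1 / 2) * (1 / 8) ^ (neighborsVia φ v M₀ A).card * 2 := by ring
        _ ≤ _ := by gcongr
    · have hfac : exposureFactor φ v (neighborsVia φ v M₀ A) t = 1 / 4 := by
        unfold exposureFactor
        rw [if_neg htv, if_neg hmem]
        norm_num
      have hlt := card_neighborsVia_lt φ hsub hagree (s := s) (by simp) hsv
        (by rwa [hM₁s]) (by rwa [hM₁s])
      have hpow' : (1 / 8 : ℝ) ^ (neighborsVia φ v M₁ (insert t (insert s A))).card ≤
          (1 / 8) ^ ((neighborsVia φ v M₀ A).card + 1) :=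
        pow_le_pow_of_le_one (by norm_num) (by norm_num) hlt
      rw [hfac]
      calc _ ≤ p * (1 / 8) ^ ((neighborsVia φ v M₀ A).card + 1) := by gcongr
        _ = _ := by ring

/-- Exponential moment of the erased degree of `v`, given the matching on a closed set `A`. -/
theorem sum_pow_card_neighborsVia_le {n N : ℕ} (φ : Fin N → Fin n) (v : Fin n) {K : ℕ}
    (hK : ∀ u, (univ.filter fun s => φ s = u).card ≤ K) {k : ℕ}
    (hk : (univ.filter fun s => φ s = v).card = k) (hN : 22 * k + 8 * (k * K) ≤ 3 * N)
    (r : ℕ) : ∀ (M₀ : Equiv.Perm (Fin N)) (A : Finset (Fin N)), (∀ a ∈ A, M₀ a ∈ A) →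
      (freeStubs φ v A).card = r → A.card + 2 * r ≤ 2 * k →
      ∑ M ∈ matchingsAgreeing M₀ A, (1 / 8 : ℝ) ^ (neighborsVia φ v M univ).card ≤
        (1 / 2) ^ r * (1 / 8) ^ (neighborsVia φ v M₀ A).card *
          (matchingsAgreeing M₀ A).card := by
  induction r using Nat.strong_induction_on with
  | _ r ih =>
  intro M₀ A hA hr hAr
  obtain rfl | hpos := Nat.eq_zero_or_pos r
  · rw [pow_zero, one_mul, mul_comm, ← nsmul_eq_mul]
    refine Finset.sum_le_card_nsmul _ _ _ fun M hM => ?_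
    rw [← neighborsVia_congr φ v (mem_matchingsAgreeing.1 hM).2]
    exact pow_le_pow_of_le_one (by norm_num) (by norm_num)
      (Finset.card_le_card (neighborsVia_mono φ v M (Finset.subset_univ _)))
  obtain ⟨s, hs⟩ := Finset.card_pos.1 (hr ▸ hpos)
  simp only [freeStubs, Finset.mem_filter, Finset.mem_compl] at hs
  obtain ⟨hs, hsv⟩ := hs
  set S := neighborsVia φ v M₀ A with hS
  set c : ℝ := ((matchingsAgreeing M₀ A).card : ℝ) with hc
  set L : ℝ := ((insert s A)ᶜ.card : ℝ) with hL
  have hLeq : L = N - A.card - 1 := card_compl_insert hs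
  have hNR : (22 * k + 8 * (k * K) : ℝ) ≤ 3 * N := by exact_mod_cast hN
  have hArR : (A.card + 2 * r : ℝ) ≤ 2 * k := by exact_mod_cast hAr
  have hrR : (1 : ℝ) ≤ r := by exact_mod_cast hpos
  have hkK : (0 : ℝ) ≤ k * K := by positivity
  have hk0 : (0 : ℝ) ≤ k := by positivity
  have hLpos : 0 < L := by linarith
  have hfiber : ∀ t ∈ (insert s A)ᶜ,
      ∑ M ∈ (matchingsAgreeing M₀ A).filter (fun M => M s = t),
        (1 / 8 : ℝ) ^ (neighborsVia φ v M univ).card ≤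
      (1 / 2) ^ r * (1 / 8) ^ S.card * exposureFactor φ v S t * (c / L) := by
    intro t ht
    have hcard : (((matchingsAgreeing M₀ A).filter fun M => M s = t).card : ℝ) = c / L := by
      rw [eq_div_iff hLpos.ne', mul_comm, hc, hL]
      exact_mod_cast card_filter_partner_mul hA hs ht
    have ht' : t ∉ insert s A := Finset.mem_compl.1 ht
    obtain hempty | ⟨M₁, hM₁⟩ :=
      ((matchingsAgreeing M₀ A).filter fun M => M s = t).eq_empty_or_nonempty
    · rw [← hcard, hempty]
      simp
    have hf1 := freeStubs_insert_of_eq φ hs hsv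
    have hf2 : (freeStubs φ v (insert t (insert s A))).card ≤
        (freeStubs φ v (insert s A)).card :=
      Finset.card_le_card (Finset.filter_subset_filter _
        (Finset.compl_subset_compl.2 (Finset.subset_insert _ _)))
    have hcardA : (insert t (insert s A)).card = A.card + 2 := by
      rw [Finset.card_insert_of_notMem ht', Finset.card_insert_of_notMem hs]
    have hih := ih _ (by omega) M₁ (insert t (insert s A)) (closed_insert_pair hA hM₁) rfl
      (by omega)
    rw [← filter_partner_eq hM₁, hcard] at hih
    refine hih.trans (mul_le_mul_of_nonneg_right ?_ (by positivity))
    rw [← hr]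
    exact exposure_step φ hs hsv ht hM₁
  have hsumfac := sum_exposureFactor_le φ v S hK (insert s A)ᶜ
  rw [hk, ← hL] at hsumfac
  have hSk : (S.card * K : ℝ) ≤ k * K := by
    have : (S.card : ℝ) ≤ k := by
      rw [← hk]
      exact_mod_cast card_neighborsVia_le φ v M₀ A
    gcongr
  rw [← Finset.sum_fiberwise_of_maps_to (fun M hM => partner_notMem hA hM hs)]
  refine (Finset.sum_le_sum hfiber).trans ?_
  rw [← Finset.sum_mul, ← Finset.mul_sum]
  have hfac : ∑ t ∈ (insert s A)ᶜ, exposureFactor φ v S t ≤ L := by linarith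
  calc _ ≤ (1 / 2) ^ r * (1 / 8) ^ S.card * L * (c / L) := by gcongr
    _ = _ := by field_simp

theorem ecmDeg_eq_card_neighborsVia {n N : ℕ} (φ : Fin N → Fin n) (v : Fin n)
    {M : Equiv.Perm (Fin N)} (hM : M ∈ matchings N) :
    ecmDeg φ M v = (neighborsVia φ v M univ).card := by
  rw [mem_matchings] at hM
  unfold ecmDeg
  congr 1
  ext u
  rw [Finset.mem_filter]
  simp only [Finset.mem_filter, Finset.mem_univ, true_and, ecmAdj, neighborsVia,
    Finset.mem_erase, Finset.mem_image]
  refine and_congr_right fun _ => ⟨?_, ?_⟩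
  · rintro ⟨s, hs, hs'⟩
    exact ⟨M s, hs', by rw [(hM s).1, hs]⟩
  · rintro ⟨s, hs, hs'⟩
    exact ⟨M s, hs', by rw [(hM s).1, hs]⟩

theorem ecmDeg_le {n N : ℕ} (φ : Fin N → Fin n) (v : Fin n)
    {M : Equiv.Perm (Fin N)} (hM : M ∈ matchings N) :
    ecmDeg φ M v ≤ (univ.filter fun s => φ s = v).card := by
  rw [ecmDeg_eq_card_neighborsVia φ v hM]
  exact card_neighborsVia_le φ v M univ

/-- Exponential moment of the erased degree of `v` on the event that two of its stubs are
matched as prescribed. -/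
theorem sum_pow_card_neighborsVia_of_two_pairs_le {n N : ℕ} (φ : Fin N → Fin n) {v : Fin n}
    {K : ℕ} (hK : ∀ u, (univ.filter fun s => φ s = u).card ≤ K) {k : ℕ}
    (hk : (univ.filter fun s => φ s = v).card = k) (hN : 22 * k + 8 * (k * K) ≤ 3 * N)
    (hN3 : 3 < N) {a b s s' : Fin N} (ha : φ a = v) (hb : φ b = v) (hs : φ s ≠ v)
    (hs' : φ s' ≠ v) (hss' : s ≠ s') :
    ∑ M ∈ (matchings N).filter (fun M => M a = s ∧ M b = s'),
        (1 / 8 : ℝ) ^ (neighborsVia φ v M univ).card ≤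
      4 * (1 / 2) ^ k * ((matchings N).card / ((N - 1) * (N - 3))) := by
  have hN3R : (3 : ℝ) < N := by exact_mod_cast hN3
  have hRHS : 0 ≤ 4 * (1 / 2 : ℝ) ^ k * ((matchings N).card / ((N - 1) * (N - 3))) := by
    have h1 : (0 : ℝ) ≤ N - 1 := by linarith
    have h3 : (0 : ℝ) ≤ N - 3 := by linarith
    positivity
  obtain hempty | ⟨M₁, hM₁⟩ :=
    ((matchings N).filter fun M => M a = s ∧ M b = s').eq_empty_or_nonempty
  · rw [hempty, Finset.sum_empty]
    exact hRHS
  obtain ⟨hM₁m, hM₁a, hM₁b⟩ := Finset.mem_filter.1 hM₁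
  have hab : b ≠ a := by
    rintro rfl
    exact hss' (hM₁a.symm.trans hM₁b)
  have hsa : s ≠ a := fun h => hs (h ▸ ha)
  have hsb : b ≠ s := fun h => hs (h ▸ hb)
  have hne_a : s' ≠ a := fun h => hs' (h ▸ ha)
  have hne_b : s' ≠ b := fun h => hs' (h ▸ hb)
  have hmem1 : M₁ ∈ (matchingsAgreeing M₁ ∅).filter fun M => M a = s := by
    rw [matchingsAgreeing_empty]
    exact Finset.mem_filter.2 ⟨hM₁m, hM₁a⟩
  have hA0 : ∀ u ∈ (∅ : Finset (Fin N)), M₁ u ∈ (∅ : Finset (Fin N)) := by simp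
  have hA1 := closed_insert_pair hA0 hmem1
  have hcard1 := card_filter_partner_mul (M₀ := M₁) hA0 (s := a) (t := s) (by simp)
    (by simp [hsa])
  rw [filter_partner_eq hmem1, matchingsAgreeing_empty] at hcard1
  have hbA : b ∉ insert s (insert a (∅ : Finset (Fin N))) := by simp [hab, hsb]
  have hmem_s' : s' ∉ insert b (insert s (insert a (∅ : Finset (Fin N)))) := by
    simp [hne_b, hss'.symm, hne_a]
  have hmem2 : M₁ ∈ (matchingsAgreeing M₁ (insert s (insert a ∅))).filter
      fun M => M b = s' := by
    simp [mem_matchingsAgreeing, hM₁m, hM₁b]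
  have hcard2 := card_filter_partner_mul hA1 hbA (t := s') (Finset.mem_compl.2 hmem_s')
  rw [filter_partner_eq hmem2] at hcard2
  have hA2 := closed_insert_pair hA1 hmem2
  have heq : ((matchings N).filter fun M => M a = s ∧ M b = s') =
      matchingsAgreeing M₁ (insert s' (insert b (insert s (insert a ∅)))) := by
    rw [← filter_partner_eq hmem2, ← filter_partner_eq hmem1, matchingsAgreeing_empty,
      Finset.filter_filter]
  have hcardA1 : (insert s (insert a (∅ : Finset (Fin N)))).card = 2 := by
    rw [Finset.card_insert_of_notMem (by simp [hsa])]
    simp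
  have hcardA2 : (insert s' (insert b (insert s (insert a (∅ : Finset (Fin N)))))).card = 4 := by
    rw [Finset.card_insert_of_notMem hmem_s', Finset.card_insert_of_notMem hbA, hcardA1]
  have hfree : (freeStubs φ v (insert s' (insert b (insert s (insert a ∅))))).card + 2 = k := by
    have h1 := freeStubs_insert_of_eq φ (v := v) (A := ∅) (s := a) (by simp) ha
    have h2 := freeStubs_insert_of_eq φ hbA hb
    rw [freeStubs_insert_of_ne φ hs']
    rw [freeStubs_insert_of_ne φ hs] at h2
    have h3 : (freeStubs φ v ∅).card = k := by
      rw [← hk]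
      simp [freeStubs]
    omega
  have hmain := sum_pow_card_neighborsVia_le φ v hK hk hN _ M₁ _ hA2 rfl (by omega)
  rw [← heq] at hmain hcard2
  have hc1 : ((N : ℝ) - 1) * (matchingsAgreeing M₁ (insert s (insert a ∅))).card =
      (matchings N).card := by
    have h := card_compl_insert (A := ∅) (s := a) (by simp)
    rw [Finset.card_empty, Nat.cast_zero, sub_zero] at h
    rw [← h]
    exact_mod_cast hcard1
  have hc2 : ((N : ℝ) - 3) * ((matchings N).filter fun M => M a = s ∧ M b = s').card =
      (matchingsAgreeing M₁ (insert s (insert a ∅))).card := by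
    have h := card_compl_insert hbA
    rw [hcardA1] at h
    rw [show (N : ℝ) - 3 = N - (2 : ℕ) - 1 by push_cast; ring, ← h]
    exact_mod_cast hcard2
  have hc : (((matchings N).filter fun M => M a = s ∧ M b = s').card : ℝ) =
      (matchings N).card / ((N - 1) * (N - 3)) := by
    have h1 : (N : ℝ) - 1 ≠ 0 := by linarith
    have h3 : (N : ℝ) - 3 ≠ 0 := by linarith
    rw [eq_div_iff (mul_ne_zero h1 h3), ← hc1, ← hc2]
    ring
  refine hmain.trans ?_
  rw [hc]
  have hdiv : (0 : ℝ) ≤ (matchings N).card / ((N - 1) * (N - 3)) := by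
    rw [← hc]
    positivity
  refine mul_le_mul_of_nonneg_right ?_ hdiv
  rw [← hfree, pow_add]
  have hle : (1 / 8 : ℝ) ^ (neighborsVia φ v M₁
      (insert s' (insert b (insert s (insert a ∅))))).card ≤ 1 :=
    pow_le_one₀ (by norm_num) (by norm_num)
  refine (mul_le_of_le_one_right (by positivity) hle).trans (le_of_eq ?_)
  ring

theorem le_sum_of_le_of_mem {ι : Type*} {S : Finset ι} {f : ι → ℝ} {a : ι} {x : ℝ}
    (hf : ∀ i, 0 ≤ f i) (ha : a ∈ S) (hx : x ≤ f a) : x ≤ ∑ i ∈ S, f i :=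
  hx.trans (Finset.single_le_sum (fun i _ => hf i) ha)

theorem ecmY_mul_ecmY_le {n N : ℕ} {d : Fin n → ℕ} {φ : Fin N → Fin n} (hφ : IsStubMap d φ)
    {v w w' : Fin n} (hdw : 6 * d w ≤ d v) {M : Equiv.Perm (Fin N)} (hM : M ∈ matchings N) :
    ecmY φ M v w * ecmY φ M v w' ≤
      (2 : ℝ) ^ ((d v : ℝ) / 2) *
        ∑ a ∈ univ.filter (fun s => φ s = v), ∑ b ∈ univ.filter (fun s => φ s = v),
          ∑ s ∈ univ.filter (fun s => φ s = w), ∑ s' ∈ univ.filter (fun s => φ s = w'),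
            if M a = s ∧ M b = s' then
              (1 / 8 : ℝ) ^ (neighborsVia φ v M univ).card else 0 := by
  set x : ℝ := (1 / 8 : ℝ) ^ (neighborsVia φ v M univ).card with hx
  have hx0 : 0 ≤ x := by positivity
  have hnn : ∀ (p : Prop) [Decidable p], 0 ≤ if p then x else 0 := fun p _ => by
    split_ifs <;> simp [hx0]
  by_cases h : inBucket φ M v w ∧ inBucket φ M v w'
  · obtain ⟨⟨⟨-, a, ha, hMa⟩, hdeg⟩, ⟨-, b, hb, hMb⟩, -⟩ := id h
    have hle : x ≤ ∑ a ∈ univ.filter (fun s => φ s = v), ∑ b ∈ univ.filter (fun s => φ s = v),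
        ∑ s ∈ univ.filter (fun s => φ s = w), ∑ s' ∈ univ.filter (fun s => φ s = w'),
          if M a = s ∧ M b = s' then x else 0 := by
      refine le_sum_of_le_of_mem (a := a) (fun _ => Finset.sum_nonneg fun _ _ =>
        Finset.sum_nonneg fun _ _ => Finset.sum_nonneg fun _ _ => hnn _) (by simp [ha]) ?_
      refine le_sum_of_le_of_mem (a := b) (fun _ => Finset.sum_nonneg fun _ _ =>
        Finset.sum_nonneg fun _ _ => hnn _) (by simp [hb]) ?_
      refine le_sum_of_le_of_mem (a := M a) (fun _ => Finset.sum_nonneg fun _ _ => hnn _)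
        (by simp [hMa]) ?_
      refine le_sum_of_le_of_mem (a := M b) (fun _ => hnn _) (by simp [hMb]) ?_
      rw [if_pos ⟨rfl, rfl⟩]
    have hD : (neighborsVia φ v M univ).card ≤ d w := by
      rw [← ecmDeg_eq_card_neighborsVia φ v hM, ← hφ w]
      refine le_trans ?_ (ecmDeg_le φ w hM)
      obtain h1 | h1 := hdeg
      exacts [h1.le, h1.1.le]
    have hone : 1 ≤ (2 : ℝ) ^ ((d v : ℝ) / 2) * x := by
      have h8 : x = (2 : ℝ) ^ (-(3 * (neighborsVia φ v M univ).card : ℝ)) := by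
        rw [hx, Real.rpow_neg (by norm_num), Real.rpow_mul (by norm_num), Real.rpow_natCast,
          one_div, inv_pow]
        norm_num
      rw [h8, ← Real.rpow_add (by norm_num)]
      refine Real.one_le_rpow (by norm_num) ?_
      have h6 : (6 * (neighborsVia φ v M univ).card : ℝ) ≤ d v := by
        exact_mod_cast (Nat.mul_le_mul_left 6 hD).trans hdw
      linarith
    simp only [ecmY, if_pos h.1, if_pos h.2, mul_one]
    exact hone.trans (mul_le_mul_of_nonneg_left hle (by positivity))
  · have hzero : ecmY φ M v w * ecmY φ M v w' = 0 := by
      unfold ecmY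
      rw [not_and_or] at h
      obtain h | h := h <;> simp [h]
    rw [hzero]
    exact mul_nonneg (by positivity) (Finset.sum_nonneg fun _ _ => Finset.sum_nonneg fun _ _ =>
      Finset.sum_nonneg fun _ _ => Finset.sum_nonneg fun _ _ => hnn _)

/-- There exist constants `δ, δ' ∈ (0,1)` such that for every degree
sequence `d` with `∑ d_v = 2m` and `max d_v < √m / 2`, and any three distinct vertices
`v, w, w'` with `d_w < δ d_v`, one has
`E[Y_{v,w} Y_{v,w'}] ≤ 2 exp(-δ' d_v) d_v² d_w d_{w'} / m²` over `ECM(d)`. -/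
theorem ecm_bucket_pair_small_degree_bound :
    ∃ δ δ' : ℝ, δ ∈ Set.Ioo (0 : ℝ) 1 ∧ δ' ∈ Set.Ioo (0 : ℝ) 1 ∧
      ∀ (n m : ℕ) (d : Fin n → ℕ) (φ : Fin (2 * m) → Fin n),
        (∀ v, 0 < d v) →
        (∑ v, d v) = 2 * m →
        (∀ v, (d v : ℝ) < Real.sqrt m / 2) →
        IsStubMap d φ →
        ∀ v w w' : Fin n, v ≠ w → v ≠ w' → w ≠ w' →
          (d w : ℝ) < δ * d v →
          ecmExp (2 * m) (fun M => ecmY φ M v w * ecmY φ M v w') ≤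
            2 * Real.exp (-δ' * d v) * (d v : ℝ) ^ 2 * (d w : ℝ) * (d w' : ℝ) /
              (m : ℝ) ^ 2 := by
  refine ⟨1 / 6, 1 / 4, by norm_num, by norm_num, ?_⟩
  intro n m d φ hpos hsum hmax hφ v w w' hvw hvw' hww' hdw
  have hsq : ∀ u, 4 * d u ^ 2 < m := by
    intro u
    have h1 : (2 * d u : ℝ) < Real.sqrt m := by linarith [hmax u]
    have h2 := (Real.lt_sqrt (by positivity)).1 h1
    have h3 : (4 * (d u : ℝ) ^ 2) < m := by linarith
    exact_mod_cast h3
  have hdw6 : 6 * d w < d v := by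
    have h : (6 * d w : ℝ) < d v := by linarith
    exact_mod_cast h
  have hv7 : 7 ≤ d v := by
    have := hpos w
    omega
  have hm : 4 * d v ^ 2 < m := hsq v
  obtain ⟨u₀, -, hu₀⟩ := Finset.exists_max_image univ d ⟨v, Finset.mem_univ v⟩
  have hK : ∀ u, (univ.filter fun s => φ s = u).card ≤ d u₀ := fun u => by
    rw [hφ u]
    exact hu₀ u (Finset.mem_univ u)
  have hN : 22 * d v + 8 * (d v * d u₀) ≤ 3 * (2 * m) := by
    have h1 := hsq u₀
    have h2 := hu₀ v (Finset.mem_univ v)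
    nlinarith
  have hm196 : 196 < m := by nlinarith
  have hmR : (196 : ℝ) < m := by exact_mod_cast hm196
  set C : ℝ := 4 * (1 / 2) ^ d v *
    ((matchings (2 * m)).card / ((((2 * m : ℕ) : ℝ) - 1) * (((2 * m : ℕ) : ℝ) - 3))) with hC
  have hbound : ∑ M ∈ matchings (2 * m), ecmY φ M v w * ecmY φ M v w' ≤
      (2 : ℝ) ^ ((d v : ℝ) / 2) * ((d v : ℝ) * (d v * (d w * (d w' * C)))) := by
    refine (Finset.sum_le_sum fun M hM => ecmY_mul_ecmY_le hφ hdw6.le hM).trans ?_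
    rw [← Finset.mul_sum]
    refine mul_le_mul_of_nonneg_left ?_ (by positivity)
    rw [Finset.sum_comm, ← hφ v, ← hφ w, ← hφ w', ← nsmul_eq_mul]
    refine Finset.sum_le_card_nsmul _ _ _ fun a ha => ?_
    rw [Finset.sum_comm, ← nsmul_eq_mul]
    refine Finset.sum_le_card_nsmul _ _ _ fun b hb => ?_
    rw [Finset.sum_comm, ← nsmul_eq_mul]
    refine Finset.sum_le_card_nsmul _ _ _ fun s hs => ?_
    rw [Finset.sum_comm, ← nsmul_eq_mul]
    refine Finset.sum_le_card_nsmul _ _ _ fun s' hs' => ?_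
    rw [← Finset.sum_filter]
    simp only [Finset.mem_filter, Finset.mem_univ, true_and] at ha hb hs hs'
    refine sum_pow_card_neighborsVia_of_two_pairs_le φ hK (hφ v) hN (by omega) ha hb
      (by rw [hs]; exact hvw.symm) (by rw [hs']; exact hvw'.symm) ?_
    rintro rfl
    exact hww' (hs.symm.trans hs')
  have hexp : (2 : ℝ) ^ ((d v : ℝ) / 2) * (1 / 2) ^ d v ≤ Real.exp (-(1 / 4) * d v) := by
    have h1 : (1 / 2 : ℝ) ^ d v = Real.exp (-(Real.log 2 * d v)) := by
      rw [Real.exp_neg, Real.exp_mul, Real.exp_log (by norm_num), Real.rpow_natCast, one_div,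
        inv_pow]
    rw [h1, Real.rpow_def_of_pos (by norm_num), ← Real.exp_add, Real.exp_le_exp]
    have h2 := Real.log_two_gt_d9
    have h3 : (0 : ℝ) ≤ d v := by positivity
    nlinarith
  have hden : 2 * (m : ℝ) ^ 2 ≤ (((2 * m : ℕ) : ℝ) - 1) * (((2 * m : ℕ) : ℝ) - 3) := by
    push_cast
    nlinarith
  unfold ecmExp
  refine div_le_of_le_mul₀ (by positivity) (by positivity) (hbound.trans ?_)
  set c : ℝ := ((matchings (2 * m)).card : ℝ)
  have hc : 0 ≤ c := by positivity
  calc (2 : ℝ) ^ ((d v : ℝ) / 2) * ((d v : ℝ) * (d v * (d w * (d w' * C))))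
      = 4 * ((2 : ℝ) ^ ((d v : ℝ) / 2) * (1 / 2) ^ d v) * ((d v : ℝ) ^ 2 * d w * d w' * c) /
          ((((2 * m : ℕ) : ℝ) - 1) * (((2 * m : ℕ) : ℝ) - 3)) := by
        rw [hC]
        ring
    _ ≤ 4 * Real.exp (-(1 / 4) * d v) * ((d v : ℝ) ^ 2 * d w * d w' * c) /
          (2 * (m : ℝ) ^ 2) := by gcongr
    _ = _ := by
        field_simp
        ring
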